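/- arXiv:1707.02187 — 3 statements merged into one kernel-verified Lean document; each statement's English description precedes it below -/
import Mathlib

section
/- Let n, x, k be natural numbers with n − 1 > x ≥ k ≥ 1, F_n(x,k) > 0, and x < 2k. Then F_n(x,k) = 2·C(n−k−1, x−k) + (n−k−1)·C(n−k−2, x−k). -/
/-- Longest run of consecutive zeros (`false`) in a binary string. -/
def longestZeroRun (l : List Bool) : ℕ :=
  Nat.findGreatest (fun k => List.replicate k false <:+: l) l.length

/-- `F n x k`: the number of binary strings of length `n` with exactly `x` zeros
whose longest run of consecutive zeros has length exactly `k`. -/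
def F (n x k : ℕ) : ℕ :=
  (Finset.univ.filter (fun s : Fin n → Bool =>
    (List.ofFn s).count false = x ∧ longestZeroRun (List.ofFn s) = k)).card

/-- The finset of words of length `m` with exactly `y` letters `false`. -/
def wordsWithZeros : ℕ → ℕ → Finset (List Bool)
  | 0, 0 => {[]}
  | 0, _ + 1 => ∅
  | m + 1, 0 => (wordsWithZeros m 0).image (List.cons true)
  | m + 1, y + 1 =>
    (wordsWithZeros m (y + 1)).image (List.cons true) ∪
      (wordsWithZeros m y).image (List.cons false)

theorem mem_wordsWithZeros (l : List Bool) (m y : ℕ) :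
    l ∈ wordsWithZeros m y ↔ l.length = m ∧ l.count false = y := by
  induction l generalizing m y with
  | nil => rcases m with _ | m <;> rcases y with _ | y <;> simp [wordsWithZeros]
  | cons b l ih =>
    rcases m with _ | m <;> rcases y with _ | y <;> cases b <;> simp [wordsWithZeros, ih]

theorem card_wordsWithZeros (m y : ℕ) : (wordsWithZeros m y).card = m.choose y := by
  induction m generalizing y with
  | zero => rcases y with _ | y <;> simp [wordsWithZeros]
  | succ m ih =>
    have inj (b : Bool) : Function.Injective (List.cons b) := List.cons_injective
    rcases y with _ | y
    · simp [wordsWithZeros, Finset.card_image_of_injective _ (inj true), ih]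
    · rw [wordsWithZeros, Finset.card_union_of_disjoint,
        Finset.card_image_of_injective _ (inj true), Finset.card_image_of_injective _ (inj false),
        ih, ih, Nat.choose_succ_succ, add_comm]
      rw [Finset.disjoint_left]
      intro l hl hl'
      simp only [Finset.mem_image] at hl hl'
      obtain ⟨u, -, rfl⟩ := hl
      obtain ⟨v, -, hv⟩ := hl'
      simp at hv

theorem F_eq_card_filter_wordsWithZeros (n x k : ℕ) :
    F n x k = ((wordsWithZeros n x).filter (fun l => longestZeroRun l = k)).card := by
  refine Finset.card_bij (fun s _ => List.ofFn s) ?_ ?_ ?_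
  · intro s hs
    simpa [mem_wordsWithZeros] using hs
  · intro s _ t _ h
    exact List.ofFn_injective h
  · intro l hl
    simp only [Finset.mem_filter, mem_wordsWithZeros] at hl
    obtain ⟨⟨rfl, hx⟩, hk⟩ := hl
    exact ⟨l.get, by simp [hx, hk], by simp⟩

theorem longestZeroRun_eq_iff (l : List Bool) {k : ℕ} (hk : 1 ≤ k) :
    longestZeroRun l = k ↔
      List.replicate k false <:+: l ∧ ¬ List.replicate (k + 1) false <:+: l := by
  rw [longestZeroRun, Nat.findGreatest_eq_iff]
  constructor
  · rintro ⟨_, h, h'⟩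
    refine ⟨h (by omega), fun hi => h' k.lt_succ_self ?_ hi⟩
    simpa using hi.length_le
  · rintro ⟨h, h'⟩
    refine ⟨by simpa using h.length_le, fun _ => h, fun j hj _ hi => h' (List.IsInfix.trans ?_ hi)⟩
    refine ⟨[], List.replicate (j - (k + 1)) false, ?_⟩
    rw [List.nil_append, List.replicate_append_replicate]
    congr 1
    omega

/-- A run of zeros cannot straddle a one. -/
theorem replicate_false_infix_append_true_cons {j : ℕ} {u v : List Bool}
    (h : List.replicate j false <:+: u ++ true :: v) :
    List.replicate j false <:+: u ∨ List.replicate j false <:+: v := by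
  obtain ⟨s, t, h⟩ := h
  rw [List.append_assoc, List.append_eq_append_iff] at h
  rcases h with ⟨w, rfl, h⟩ | ⟨w, rfl, h⟩
  · rw [List.append_eq_append_iff] at h
    rcases h with ⟨w', rfl, -⟩ | ⟨w', h', h⟩
    · exact Or.inl ⟨s, w', by simp⟩
    · rcases w' with _ | ⟨b, w'⟩
      · exact Or.inl ⟨s, [], by simpa using h'⟩
      · have hb : b ∈ List.replicate j false := by simp [h']
        have := List.eq_of_mem_replicate hb
        simp_all
  · rcases w with _ | ⟨b, w⟩
    · rcases j with _ | j
      · exact Or.inl ⟨[], u, by simp⟩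
      · simp [List.replicate_succ] at h
    · simp only [List.cons_append, List.cons.injEq] at h
      exact Or.inr ⟨w, t, by simp [h.2]⟩

theorem left_factor_length_le {k : ℕ} {a b a' b' : List Bool}
    (h : a ++ (List.replicate k false ++ b) = a' ++ (List.replicate k false ++ b'))
    (ha' : ¬ [false] <:+ a')
    (hc : (a ++ (List.replicate k false ++ b)).count false < 2 * k) : a'.length ≤ a.length := by
  by_contra! hlt
  rw [h] at hc
  rw [List.append_eq_append_iff] at h
  rcases h with ⟨t, rfl, h⟩ | ⟨t, rfl, h⟩
  · rw [List.append_eq_append_iff] at h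
    rcases h with ⟨w, rfl, -⟩ | ⟨w, h', -⟩
    · simp at hc
      omega
    · rcases List.eq_nil_or_concat t with rfl | ⟨t, c, rfl⟩
      · simp at hlt
      · have hm : c ∈ List.replicate k false := by simp [h']
        obtain rfl := List.eq_of_mem_replicate hm
        exact ha' ⟨a ++ t, by simp⟩
  · simp at hlt

/-- In a word with fewer than `2 * k` zeros, a factor `0 ^ k` not preceded by a zero is unique. -/
theorem factorization_unique {k : ℕ} {a b a' b' : List Bool}
    (h : a ++ (List.replicate k false ++ b) = a' ++ (List.replicate k false ++ b'))
    (ha : ¬ [false] <:+ a) (ha' : ¬ [false] <:+ a')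
    (hc : (a ++ (List.replicate k false ++ b)).count false < 2 * k) : a = a' ∧ b = b' := by
  have h₁ := left_factor_length_le h ha' hc
  have h₂ := left_factor_length_le h.symm ha (h ▸ hc)
  obtain ⟨rfl, h'⟩ := List.append_inj h (by omega)
  exact ⟨rfl, List.append_cancel_left h'⟩

theorem not_singleton_false_suffix_append_true (u : List Bool) : ¬ [false] <:+ u ++ [true] := by
  rintro ⟨t, ht⟩
  simpa using (List.append_inj' ht rfl).2

theorem exists_eq_append_true_of_not_suffix {a : List Bool} (h : ¬ [false] <:+ a) :
    a = [] ∨ ∃ u, a = u ++ [true] := by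
  rcases List.eq_nil_or_concat a with rfl | ⟨u, c, rfl⟩
  · exact Or.inl rfl
  · cases c
    · exact absurd ⟨u, by simp⟩ h
    · exact Or.inr ⟨u, by simp⟩

/-- The word obtained by inserting `1 0 ^ k 1` at position `i` of `c`, where `p = (i, c)`. -/
def insertZeroRun (k : ℕ) (p : ℕ × List Bool) : List Bool :=
  (p.2.take p.1 ++ [true]) ++ (List.replicate k false ++ true :: p.2.drop p.1)

theorem longestZeroRun_prefix {k : ℕ} {c : List Bool} (hk : 1 ≤ k) (hc : c.count false < k) :
    longestZeroRun (List.replicate k false ++ true :: c) = k := by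
  rw [longestZeroRun_eq_iff _ hk]
  refine ⟨⟨[], true :: c, by simp⟩, fun h => ?_⟩
  rcases replicate_false_infix_append_true_cons h with h | h
  · simpa using h.length_le
  · have := h.sublist.count_le false
    simp at this
    omega

theorem longestZeroRun_append {k : ℕ} {u b : List Bool}
    (hk : 1 ≤ k) (hu : u.count false < k) (hb : longestZeroRun b = k) :
    longestZeroRun ((u ++ [true]) ++ b) = k := by
  rw [longestZeroRun_eq_iff _ hk] at hb ⊢
  refine ⟨hb.1.trans ⟨u ++ [true], [], by simp⟩, fun h => ?_⟩
  rw [List.append_assoc, List.singleton_append] at h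
  rcases replicate_false_infix_append_true_cons h with h | h
  · have := h.sublist.count_le false
    simp at this
    omega
  · exact hb.2 h

theorem longestZeroRun_replicate {k : ℕ} (hk : 1 ≤ k) :
    longestZeroRun (List.replicate k false) = k := by
  rw [longestZeroRun_eq_iff _ hk]
  exact ⟨List.infix_rfl, fun h => by simpa using h.length_le⟩

theorem exists_factorization_of_longestZeroRun_eq {l : List Bool} {k : ℕ} (hk : 1 ≤ k)
    (h : longestZeroRun l = k) :
    ∃ a b, l = a ++ (List.replicate k false ++ b) ∧ (a = [] ∨ ∃ u, a = u ++ [true]) ∧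
      (b = [] ∨ ∃ v, b = true :: v) := by
  obtain ⟨⟨a, b, rfl⟩, h⟩ := (longestZeroRun_eq_iff _ hk).1 h
  refine ⟨a, b, by simp, exists_eq_append_true_of_not_suffix ?_, ?_⟩
  · rintro ⟨u, rfl⟩
    exact h ⟨u, b, by simp [List.replicate_succ]⟩
  · rcases b with _ | ⟨c, v⟩
    · exact Or.inl rfl
    · cases c
      · exact absurd ⟨a, v, by simp [List.replicate_succ']⟩ h
      · exact Or.inr ⟨v, rfl⟩

theorem filter_longestZeroRun_eq {n x k : ℕ} (h1 : x < n - 1) (h2 : k ≤ x) (h3 : 1 ≤ k)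
    (h5 : x < 2 * k) :
    (wordsWithZeros n x).filter (fun l => longestZeroRun l = k) =
      ((wordsWithZeros (n - k - 1) (x - k)).image (fun c => List.replicate k false ++ true :: c) ∪
        (wordsWithZeros (n - k - 1) (x - k)).image
          (fun c => (c ++ [true]) ++ List.replicate k false)) ∪
      (Finset.range (n - k - 1) ×ˢ wordsWithZeros (n - k - 2) (x - k)).image (insertZeroRun k) := by
  ext l
  simp only [Finset.mem_filter, Finset.mem_union, Finset.mem_image, Finset.mem_product,
    Finset.mem_range, mem_wordsWithZeros, Prod.exists]
  constructor
  · rintro ⟨⟨hn, hx⟩, hl⟩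
    obtain ⟨a, b, rfl, rfl | ⟨u, rfl⟩, rfl | ⟨v, rfl⟩⟩ :=
      exists_factorization_of_longestZeroRun_eq h3 hl <;> simp at hn hx
    · omega
    · exact Or.inl (Or.inl ⟨v, ⟨by omega, by omega⟩, by simp⟩)
    · exact Or.inl (Or.inr ⟨u, ⟨by omega, by omega⟩, by simp⟩)
    · refine Or.inr ⟨u.length, u ++ v, ⟨by omega, ?_, ?_⟩, by simp [insertZeroRun]⟩
      · simp
        omega
      · simp
        omega
  · rintro ((⟨c, ⟨hn, hx⟩, rfl⟩ | ⟨c, ⟨hn, hx⟩, rfl⟩) | ⟨i, c, ⟨hi, hn, hx⟩, rfl⟩)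
    · refine ⟨⟨?_, ?_⟩, longestZeroRun_prefix h3 (by omega)⟩ <;> simp [hn, hx] <;> omega
    · refine ⟨⟨?_, ?_⟩, longestZeroRun_append h3 (by omega) (longestZeroRun_replicate h3)⟩ <;>
        simp [hn, hx] <;> omega
    · have hc : (c.take i).count false + (c.drop i).count false = x - k := by
        rw [← List.count_append, List.take_append_drop, hx]
      refine ⟨⟨?_, ?_⟩, longestZeroRun_append h3 (by dsimp only; omega)
        (longestZeroRun_prefix h3 (by dsimp only; omega))⟩ <;> simp [insertZeroRun] <;> omega

/-- For `n - 1 > x ≥ k ≥ 1` with `F n x k > 0` and `x < 2k`: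
`F n x k = 2·C(n-k-1, x-k) + (n-k-1)·C(n-k-2, x-k)`. -/
theorem F_explicit (n x k : ℕ) (h1 : x < n - 1) (h2 : k ≤ x) (h3 : 1 ≤ k)
    (h4 : 0 < F n x k) (h5 : x < 2 * k) :
    F n x k = 2 * (n - k - 1).choose (x - k) + (n - k - 1) * (n - k - 2).choose (x - k) := by
  rw [F_eq_card_filter_wordsWithZeros]
  rw [filter_longestZeroRun_eq h1 h2 h3 h5, Finset.card_union_of_disjoint,
    Finset.card_union_of_disjoint, Finset.card_image_of_injOn, Finset.card_image_of_injOn,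
    Finset.card_image_of_injOn, Finset.card_product, Finset.card_range, card_wordsWithZeros,
    card_wordsWithZeros, two_mul]
  · rintro ⟨i, c⟩ hc ⟨j, d⟩ hd h
    simp only [Finset.coe_product, Set.mem_prod, Finset.mem_coe, Finset.mem_range,
      mem_wordsWithZeros] at hc hd
    obtain ⟨ha, hb⟩ := factorization_unique h (not_singleton_false_suffix_append_true _)
      (not_singleton_false_suffix_append_true _) (by
        have : (c.take i).count false + (c.drop i).count false = x - k := by
          rw [← List.count_append, List.take_append_drop, hc.2.2]
        simp
        omega)
    have ha' := List.append_cancel_right ha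
    have hb' := (List.cons.inj hb).2
    have hij := congrArg List.length ha'
    simp only [List.length_take] at ha' hb' hij
    have hcd : c = d := by
      rw [← List.take_append_drop i c, ← List.take_append_drop j d, ha', hb']
    have : i = j := by omega
    rw [this, hcd]
  · intro c _ d _ h
    simpa using h
  · intro c _ d _ h
    simpa using h
  · rw [Finset.disjoint_left]
    intro l hl hl'
    simp only [Finset.mem_image, mem_wordsWithZeros] at hl hl'
    obtain ⟨c, ⟨-, hc⟩, rfl⟩ := hl
    obtain ⟨d, -, h⟩ := hl'
    have := (factorization_unique (a' := []) (b := []) (by simpa using h)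
      (not_singleton_false_suffix_append_true d) (by simp) (by
        rw [List.append_nil, h]
        simp
        omega)).1
    simp at this
  · rw [Finset.disjoint_left]
    intro l hl hl'
    simp only [Finset.mem_union, Finset.mem_image, mem_wordsWithZeros] at hl hl'
    obtain ⟨⟨i, d⟩, -, rfl⟩ := hl'
    rcases hl with ⟨c, ⟨-, hc⟩, h⟩ | ⟨c, ⟨-, hc⟩, h⟩
    · have := (factorization_unique (a := []) h (by simp)
        (not_singleton_false_suffix_append_true _) (by
          simp
          omega)).1
      simp at this
    · have := (factorization_unique (b := []) (by simpa [insertZeroRun] using h)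
        (not_singleton_false_suffix_append_true c)
        (not_singleton_false_suffix_append_true (d.take i)) (by
          simp
          omega) (b' := true :: d.drop i)).2
      simp at this
end

section
/- Let n > x ≥ k ≥ 3 be natural numbers. Then P_{n+1}(x,k) = Σ_{j=⌊(n−k−1)/(n−x)⌋}^{k} P_{n−k}(x−k, j). -/
/-- The multiset of lengths of the maximal runs of zeros (`false`) in a binary string. -/
def zeroRunLengths (l : List Bool) : Multiset ℕ :=
  (((l.splitOn true).map List.length).filter (· != 0) : List ℕ)

/-- `P m y j` (denoted `P_{m+1}(y, j)` in the paper): the number of distinct multisets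
of zero-run lengths realized by binary strings of length `m` with exactly `y` zeros
whose longest run of zeros has length exactly `j`. -/
def P (m y j : ℕ) : ℕ :=
  ((Finset.univ.filter (fun s : Fin m → Bool =>
      (List.ofFn s).count false = y ∧ longestZeroRun (List.ofFn s) = j)).image
    (fun s => zeroRunLengths (List.ofFn s))).card

/-- Splitting a binary string at its ones: the first piece is the initial run of zeros, the pieces
bound the runs of zeros, and their number and total length count the ones and the zeros. -/
theorem splitOn_true_spec (l : List Bool) :
    ∃ h t, l.splitOn true = h :: t ∧
      (∀ k, List.replicate k false <+: l ↔ k ≤ h.length) ∧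
      (∀ k, List.replicate k false <:+: l ↔ ∃ p ∈ h :: t, k ≤ p.length) ∧
      ((h :: t).map List.length).sum = l.count false ∧
      (h :: t).length = l.count true + 1 := by
  induction l with
  | nil =>
    refine ⟨[], [], by simp, ?_, ?_, by simp, by simp⟩ <;> intro k <;> simp
  | cons a l ih =>
    obtain ⟨h, t, hs, hp, hi, hsum, hlen⟩ := ih
    cases a with
    | true =>
      have key : ∀ k, List.replicate k false <+: true :: l ↔ k ≤ 0 := by
        intro k
        cases k <;> simp [List.replicate_succ]
      refine ⟨[], h :: t, by simp [List.splitOn_cons_eq_if_modifyHead, hs], by simpa using key,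
        ?_, by simpa using hsum, by simpa using hlen⟩
      intro k
      rw [List.infix_cons_iff, key, hi, List.exists_mem_cons_iff (a := [])]
      rfl
    | false =>
      have key : ∀ k, List.replicate k false <+: false :: l ↔ k ≤ h.length + 1 := by
        intro k
        cases k with
        | zero => simp
        | succ k => simp [List.replicate_succ, hp]
      refine ⟨false :: h, t, by simp [List.splitOn_cons_eq_if_modifyHead, hs], by simpa using key,
        ?_, ?_, by simpa using hlen⟩
      · intro k
        rw [List.infix_cons_iff, key, hi]
        simp only [List.exists_mem_cons_iff, List.length_cons]
        constructor
        · rintro (h1 | h1 | h1)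
          · exact Or.inl h1
          · exact Or.inl (by omega)
          · exact Or.inr h1
        · rintro (h1 | h1)
          · exact Or.inl h1
          · exact Or.inr (Or.inr h1)
      · simp at hsum ⊢
        omega

theorem sum_zeroRunLengths (l : List Bool) : (zeroRunLengths l).sum = l.count false := by
  obtain ⟨h, t, hs, -, -, hsum, -⟩ := splitOn_true_spec l
  rw [zeroRunLengths, hs, ← hsum, Multiset.sum_coe]
  generalize (h :: t).map List.length = r
  induction r with
  | nil => rfl
  | cons a r ih =>
    by_cases ha : a = 0 <;> simp [ha, ih]

theorem card_zeroRunLengths_le (l : List Bool) :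
    (zeroRunLengths l).card ≤ l.count true + 1 := by
  obtain ⟨h, t, hs, -, -, -, hlen⟩ := splitOn_true_spec l
  rw [zeroRunLengths, hs, ← hlen, Multiset.coe_card]
  exact (List.length_filter_le _ _).trans (by simp)

theorem zero_notMem_zeroRunLengths (l : List Bool) : 0 ∉ zeroRunLengths l := by
  simp [zeroRunLengths]

theorem replicate_false_infix_iff (l : List Bool) (k : ℕ) :
    List.replicate k false <:+: l ↔ k ≤ (zeroRunLengths l).sup := by
  obtain ⟨h, t, hs, -, hi, -, -⟩ := splitOn_true_spec l
  rcases Nat.eq_zero_or_pos k with rfl | hk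
  · simp
  rw [hi, ← not_lt, ← not_iff_not, not_not,
    Nat.lt_iff_le_pred hk, Multiset.sup_le, zeroRunLengths, hs]
  simp only [Multiset.mem_coe, List.mem_filter, List.mem_map]
  constructor
  · rintro hn _ ⟨⟨p, hp, rfl⟩, -⟩
    have : ¬ k ≤ p.length := fun h' => hn ⟨p, hp, h'⟩
    omega
  · rintro hn ⟨p, hp, hkp⟩
    have := hn p.length ⟨⟨p, hp, rfl⟩, by simp only [bne_iff_ne]; omega⟩
    omega

theorem longestZeroRun_eq_sup (l : List Bool) :
    longestZeroRun l = (zeroRunLengths l).sup := by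
  have hsup : List.replicate (zeroRunLengths l).sup false <:+: l :=
    (replicate_false_infix_iff l _).2 le_rfl
  refine le_antisymm ?_ (Nat.le_findGreatest (by simpa using hsup.length_le) hsup)
  exact (replicate_false_infix_iff l _).1
    (Nat.findGreatest_spec (P := fun k => List.replicate k false <:+: l) (Nat.zero_le _) (by simp))

theorem exists_zeroRunLengths_eq (M : Multiset ℕ) (hM : 0 ∉ M) (c : ℕ) (hc : M.card ≤ c + 1) :
    ∃ l : List Bool, zeroRunLengths l = M ∧ l.count true = c := by
  set r : List ℕ := M.toList ++ List.replicate (c + 1 - M.card) 0 with hr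
  have hlen : r.length = c + 1 := by
    simp [hr]
    omega
  have hsplit : ([true].intercalate (r.map (List.replicate · false))).splitOn true =
      r.map (List.replicate · false) := by
    refine List.splitOn_intercalate true ?_ ?_
    · simp
    · intro h
      have : r.length = 0 := by simpa using congrArg List.length h
      omega
  refine ⟨[true].intercalate (r.map (List.replicate · false)), ?_, ?_⟩
  · have hfil : M.toList.filter (· != 0) = M.toList := by
      rw [List.filter_eq_self]
      intro a ha
      simp only [bne_iff_ne]
      rintro rfl
      exact hM (Multiset.mem_toList.1 ha)
    have hmap : (r.map (List.replicate · false)).map List.length = r := by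
      simp [Function.comp_def]
    rw [zeroRunLengths, hsplit, hmap, hr, List.filter_append, hfil]
    simp
  · obtain ⟨h, t, hs, -, -, -, hl⟩ :=
      splitOn_true_spec ([true].intercalate (r.map (List.replicate · false)))
    rw [← hs, hsplit, List.length_map, hlen] at hl
    omega

/-- The multisets counted by `P m y j`. -/
def zeroRunMultisets (m y j : ℕ) : Finset (Multiset ℕ) :=
  (Finset.univ.filter (fun s : Fin m → Bool =>
      (List.ofFn s).count false = y ∧ longestZeroRun (List.ofFn s) = j)).image
    (fun s => zeroRunLengths (List.ofFn s))

theorem mem_zeroRunMultisets {m y j : ℕ} (hy : y ≤ m) {M : Multiset ℕ} :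
    M ∈ zeroRunMultisets m y j ↔
      M.sum = y ∧ 0 ∉ M ∧ M.card ≤ m - y + 1 ∧ M.sup = j := by
  simp only [zeroRunMultisets, Finset.mem_image, Finset.mem_filter, Finset.mem_univ, true_and]
  constructor
  · rintro ⟨s, ⟨hcount, hlong⟩, rfl⟩
    have hlen := List.count_false_add_count_true (List.ofFn s)
    rw [List.length_ofFn] at hlen
    refine ⟨by rw [sum_zeroRunLengths, hcount], zero_notMem_zeroRunLengths _, ?_,
      by rw [← longestZeroRun_eq_sup, hlong]⟩
    have := card_zeroRunLengths_le (List.ofFn s)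
    omega
  · rintro ⟨hsum, h0, hcard, hsup⟩
    obtain ⟨l, rfl, hl⟩ := exists_zeroRunLengths_eq M h0 _ hcard
    rw [sum_zeroRunLengths] at hsum
    have hlen := List.count_false_add_count_true l
    obtain rfl : l.length = m := by omega
    refine ⟨l.get, ?_, ?_⟩ <;> rw [List.ofFn_get]
    exact ⟨hsum, by rw [longestZeroRun_eq_sup, hsup]⟩

theorem zeroRunMultisets_eq_image_cons {n x k : ℕ} (hx : x < n) (hk : k ≤ x) (hpos : 0 < k) :
    zeroRunMultisets n x k =
      ((Finset.Icc ((n - k - 1) / (n - x)) k).biUnion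
        (zeroRunMultisets (n - k - 1) (x - k))).image (k ::ₘ ·) := by
  ext M
  simp only [Finset.mem_image, Finset.mem_biUnion, Finset.mem_Icc,
    mem_zeroRunMultisets (show x ≤ n by omega),
    mem_zeroRunMultisets (show x - k ≤ n - k - 1 by omega)]
  constructor
  · rintro ⟨hsum, h0, hcard, hsup⟩
    have hkM : k ∈ M := by
      by_contra hkM
      have : M.sup ≤ k - 1 := Multiset.sup_le.2 fun b hb => by
        have h1 : b ≤ k := hsup ▸ Multiset.le_sup hb
        have h2 : b ≠ k := fun h => hkM (h ▸ hb)
        omega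
      omega
    obtain ⟨N, rfl⟩ := Multiset.exists_cons_of_mem hkM
    simp only [Multiset.sum_cons, Multiset.mem_cons, not_or, Multiset.card_cons,
      Multiset.sup_cons, sup_eq_left] at hsum h0 hcard hsup
    refine ⟨N, ⟨N.sup, ⟨?_, hsup⟩, by omega, h0.2, by omega, rfl⟩, rfl⟩
    have hle : N.sum ≤ N.card * N.sup := by
      simpa using Multiset.sum_le_card_nsmul N N.sup fun b hb => Multiset.le_sup hb
    have hle' : N.card * N.sup ≤ (n - x) * N.sup := Nat.mul_le_mul_right _ (by omega)
    rw [← Nat.lt_succ_iff, Nat.div_lt_iff_lt_mul (by omega), Nat.succ_mul, Nat.mul_comm N.sup]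
    omega
  · rintro ⟨N, ⟨j, ⟨-, hjk⟩, hsum, h0, hcard, hsup⟩, rfl⟩
    simp only [Multiset.sum_cons, Multiset.mem_cons, not_or, Multiset.card_cons,
      Multiset.sup_cons, sup_eq_left]
    exact ⟨by omega, ⟨by omega, h0⟩, by omega, by omega⟩

/-- For `n > x ≥ k ≥ 3`,
`P_{n+1}(x, k) = ∑_{j=⌊(n-k-1)/(n-x)⌋}^{k} P_{n-k}(x-k, j)`. -/
theorem P_recurrence (n x k : ℕ) (h1 : x < n) (h2 : k ≤ x) (h3 : 3 ≤ k) :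
    P n x k = ∑ j ∈ Finset.Icc ((n - k - 1) / (n - x)) k, P (n - k - 1) (x - k) j := by
  change (zeroRunMultisets n x k).card =
    ∑ j ∈ Finset.Icc ((n - k - 1) / (n - x)) k, (zeroRunMultisets (n - k - 1) (x - k) j).card
  rw [zeroRunMultisets_eq_image_cons h1 h2 (by omega),
    Finset.card_image_of_injective _ fun _ _ => (Multiset.cons_inj_right k).1, Finset.card_biUnion]
  intro i _ j _ hij
  have hy : x - k ≤ n - k - 1 := by omega
  refine Finset.disjoint_left.2 fun M hi hj => hij ?_
  rw [← ((mem_zeroRunMultisets hy).1 hi).2.2.2, ((mem_zeroRunMultisets hy).1 hj).2.2.2]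
end

section
/- Let n, x, k be positive integers with 2k ≤ x, and assume x is even whenever n is even. Set q = ⌊x/k⌋. Then F̂_n(x,k) > 0 if and only if: x + q − 1 ≤ n when k divides x, and x + q ≤ n when k does not divide x. -/
/-- `Fhat n x k`: the number of palindromic binary strings of length `n` with exactly
`x` zeros whose longest run of consecutive zeros has length exactly `k`. -/
def Fhat (n x k : ℕ) : ℕ :=
  (Finset.univ.filter (fun s : Fin n → Bool =>
    (List.ofFn s).reverse = List.ofFn s ∧
    (List.ofFn s).count false = x ∧ longestZeroRun (List.ofFn s) = k)).card

open List in
theorem replicate_false_prefix_append_true {m : ℕ} {A B : List Bool}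
    (h : replicate m false <+: A ++ true :: B) : replicate m false <+: A := by
  induction A generalizing m with
  | nil =>
    cases m with
    | zero => simp
    | succ m => simp [replicate_succ, cons_prefix_cons] at h
  | cons a A ih =>
    cases m with
    | zero => simp
    | succ m =>
      simp only [replicate_succ, cons_append, cons_prefix_cons] at h ⊢
      exact ⟨h.1, ih h.2⟩

open List in
/-- A block of zeros cannot straddle a one. -/
theorem replicate_false_infix_append_true {m : ℕ} {A B : List Bool}
    (h : replicate m false <:+: A ++ true :: B) :
    replicate m false <:+: A ∨ replicate m false <:+: B := by
  induction A with
  | nil =>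
    rcases infix_cons_iff.1 h with h | h
    · exact Or.inl (replicate_false_prefix_append_true (A := []) h).isInfix
    · exact Or.inr h
  | cons a A ih =>
    rw [cons_append, infix_cons_iff] at h
    rcases h with h | h
    · exact Or.inl (replicate_false_prefix_append_true (A := a :: A) h).isInfix
    · exact (ih h).imp_left fun h => infix_cons h

theorem longestZeroRun_eq {l : List Bool} {k : ℕ} (h : List.replicate k false <:+: l)
    (h' : ¬ List.replicate (k + 1) false <:+: l) : longestZeroRun l = k := by
  have hl := h.length_le
  rw [List.length_replicate] at hl
  refine le_antisymm ?_ (Nat.le_findGreatest hl h)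
  by_contra! hlt
  have hs : List.replicate (longestZeroRun l) false <:+: l :=
    Nat.findGreatest_spec (P := fun k => List.replicate k false <:+: l) hl h
  refine h' (List.IsInfix.trans (List.IsPrefix.isInfix ?_) hs)
  exact ⟨List.replicate (longestZeroRun l - (k + 1)) false, by
    rw [List.replicate_append_replicate]; congr 1; omega⟩

theorem not_replicate_succ_longestZeroRun_infix (l : List Bool) :
    ¬ List.replicate (longestZeroRun l + 1) false <:+: l := by
  intro h
  have hl := h.length_le
  rw [List.length_replicate] at hl
  have : longestZeroRun l + 1 ≤ longestZeroRun l :=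
    Nat.le_findGreatest (P := fun k => List.replicate k false <:+: l) hl h
  omega

open List in
theorem count_false_le_of_replicate_append {k : ℕ} (l : List Bool) (j : ℕ)
    (h : ¬ replicate (k + 1) false <:+: replicate j false ++ l) :
    j + l.count false ≤ k * (l.count true + 1) := by
  have hj : j ≤ k := by
    by_contra! hlt
    refine h (IsPrefix.isInfix ⟨replicate (j - (k + 1)) false ++ l, ?_⟩)
    rw [← append_assoc, replicate_append_replicate]
    congr 2
    omega
  induction l generalizing j with
  | nil => simpa using hj
  | cons a l ih =>
    cases a with
    | false =>
      have h' : ¬ replicate (k + 1) false <:+: replicate (j + 1) false ++ l := by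
        simpa [replicate_succ'] using h
      have hj' : j + 1 ≤ k := by
        by_contra! hlt
        obtain rfl : j = k := by omega
        exact h' (prefix_append _ _).isInfix
      have := ih (j + 1) h' hj'
      simp only [count_cons_self, count_cons_of_ne (by decide : false ≠ true)]
      omega
    | true =>
      have := ih 0 (fun hi => h (hi.trans ((suffix_cons true l).isInfix.trans
        (suffix_append _ _).isInfix))) (Nat.zero_le _)
      simp only [count_cons_self, count_cons_of_ne (by decide : true ≠ false)]
      nlinarith

open List in
theorem exists_list_counts_replicate_infix {k : ℕ} (r s : ℕ) (h : s ≤ k * (r + 1)) :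
    ∃ l : List Bool, l.count false = s ∧ l.count true = r ∧
      replicate (min s k) false <:+: l ∧ ¬ replicate (k + 1) false <:+: l := by
  have not_infix {j : ℕ} (hj : j ≤ k) : ¬ replicate (k + 1) false <:+: replicate j false := by
    intro hi
    have := hi.length_le
    simp only [length_replicate] at this
    omega
  induction r generalizing s with
  | zero =>
    have hs : s ≤ k := by simpa using h
    exact ⟨replicate s false, by simp, by simp [count_replicate],
      by rw [min_eq_left hs], not_infix hs⟩
  | succ r ih =>
    obtain ⟨l, hf, ht, -, hl⟩ := ih (s - min s k) (by
      rw [Nat.mul_succ] at h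
      omega)
    refine ⟨replicate (min s k) false ++ true :: l, ?_, ?_, (prefix_append _ _).isInfix, ?_⟩
    · simp [hf]
    · simp [count_replicate, ht]
    · intro hi
      exact (replicate_false_infix_append_true hi).elim (not_infix (min_le_right _ _)) hl

open List in
/-- A palindrome is obtained by putting two mirror images around a palindromic centre that is
delimited by ones. -/
theorem exists_palindrome {k r s c : ℕ} (hc : c ≤ k) (hks : k ≤ s) (hs : s ≤ k * (r + 1)) :
    (∃ l : List Bool, l.reverse = l ∧ l.count false = 2 * s ∧ l.count true = 2 * r + 1 ∧
      longestZeroRun l = k) ∧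
    ∃ l : List Bool, l.reverse = l ∧ l.count false = 2 * s + c ∧ l.count true = 2 * r + 2 ∧
      longestZeroRun l = k := by
  obtain ⟨u, hf, ht, hi, hu⟩ := exists_list_counts_replicate_infix r s hs
  rw [min_eq_right hks] at hi
  have hu' : ¬ replicate (k + 1) false <:+: u.reverse := by
    intro h
    exact hu (by simpa using reverse_infix.2 h)
  refine ⟨⟨u ++ true :: u.reverse, by simp, by simp [hf]; omega, by simp [ht]; omega,
    longestZeroRun_eq (hi.trans (prefix_append _ _).isInfix) fun h => ?_⟩,
    ⟨u ++ true :: (replicate c false ++ true :: u.reverse), by simp, by simp [hf]; omega,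
    by simp [ht, count_replicate]; omega,
    longestZeroRun_eq (hi.trans (prefix_append _ _).isInfix) fun h => ?_⟩⟩
  · exact (replicate_false_infix_append_true h).elim hu hu'
  · rcases replicate_false_infix_append_true h with h | h
    · exact hu h
    rcases replicate_false_infix_append_true h with h | h
    · have := h.length_le
      simp only [length_replicate] at this
      omega
    · exact hu' h

theorem Fhat_pos_iff_exists (n x k : ℕ) :
    0 < Fhat n x k ↔ ∃ l : List Bool, l.reverse = l ∧ l.count false = x ∧
      l.count true + x = n ∧ longestZeroRun l = k := by
  simp only [Fhat, Finset.card_pos, Finset.Nonempty, Finset.mem_filter, Finset.mem_univ,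
    true_and]
  constructor
  · rintro ⟨s, hs, hx, hk⟩
    refine ⟨List.ofFn s, hs, hx, ?_, hk⟩
    rw [← hx, List.count_true_add_count_false, List.length_ofFn]
  · rintro ⟨l, hl, rfl, hn, hk⟩
    rw [List.count_true_add_count_false] at hn
    subst hn
    exact ⟨l.get, by rw [List.ofFn_get]; exact ⟨hl, rfl, hk⟩⟩

theorem le_mul_succ_iff_div {x k t : ℕ} (hk : 0 < k) :
    x ≤ k * (t + 1) ↔ if k ∣ x then x / k ≤ t + 1 else x / k ≤ t := by
  split_ifs with h
  · obtain ⟨q, rfl⟩ := h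
    rw [Nat.mul_div_cancel_left q hk, Nat.mul_le_mul_left_iff hk]
  · have hne : x ≠ k * (t + 1) := fun he => h ⟨_, he⟩
    rw [← Nat.lt_succ_iff (n := t), Nat.div_lt_iff_lt_mul hk, Nat.mul_comm t.succ]
    exact ⟨fun hle => lt_of_le_of_ne hle hne, le_of_lt⟩

/-- For positive `n, x, k` with `2k ≤ x` and `x` even whenever `n` is even, putting
`q = ⌊x/k⌋`: `Fhat n x k > 0` iff `x + q - 1 ≤ n` when `k ∣ x`, and `x + q ≤ n`
when `k ∤ x`. -/
theorem Fhat_pos_iff (n x k : ℕ) (hn : 0 < n) (hx : 0 < x) (hk : 0 < k)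
    (h2k : 2 * k ≤ x) (hpar : Even n → Even x) :
    0 < Fhat n x k ↔ (if k ∣ x then x + x / k - 1 ≤ n else x + x / k ≤ n) := by
  have hq : 2 ≤ x / k := (Nat.le_div_iff_mul_le hk).2 h2k
  have hcond : (if k ∣ x then x + x / k - 1 ≤ n else x + x / k ≤ n) ↔
      ∃ t, n = x + t ∧ x ≤ k * (t + 1) := by
    simp only [le_mul_succ_iff_div hk]
    split_ifs
    · exact ⟨fun h => ⟨n - x, by omega, by omega⟩, by rintro ⟨t, rfl, h⟩; omega⟩
    · exact ⟨fun h => ⟨n - x, by omega, by omega⟩, by rintro ⟨t, rfl, h⟩; omega⟩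
  rw [hcond, Fhat_pos_iff_exists]
  constructor
  · rintro ⟨l, -, rfl, rfl, rfl⟩
    refine ⟨l.count true, by omega, ?_⟩
    simpa using count_false_le_of_replicate_append l 0
      (by simpa using not_replicate_succ_longestZeroRun_infix l)
  · rintro ⟨t, rfl, hxt⟩
    rcases Nat.even_or_odd' t with ⟨r, rfl | rfl⟩
    · obtain ⟨r, rfl⟩ : ∃ r', r = r' + 1 := by
        refine Nat.exists_eq_succ_of_ne_zero ?_
        rintro rfl
        omega
      obtain ⟨s, c, hc, hks, hs, rfl⟩ :
          ∃ s c, c ≤ k ∧ k ≤ s ∧ s ≤ k * (r + 1) ∧ x = 2 * s + c := by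
        have hexp : k * (2 * (r + 1) + 1) = 2 * (k * (r + 1)) + k := by ring
        by_cases hle : x ≤ 2 * (k * (r + 1))
        · exact ⟨x / 2, x % 2, by omega, by omega, by omega, by omega⟩
        · exact ⟨k * (r + 1), x - 2 * (k * (r + 1)), by omega,
            Nat.le_mul_of_pos_right k r.succ_pos, le_rfl, by omega⟩
      obtain ⟨l, hl, hf, ht, hk⟩ := (exists_palindrome hc hks hs).2
      exact ⟨l, hl, hf, by omega, hk⟩
    · have hex : Even x := by
        rcases Nat.even_or_odd x with h | h
        · exact h
        · exact hpar (h.add_odd (odd_two_mul_add_one r))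
      obtain ⟨s, rfl⟩ := hex.two_dvd
      have hexp : k * (2 * r + 1 + 1) = 2 * (k * (r + 1)) := by ring
      obtain ⟨l, hl, hf, ht, hk⟩ :=
        (exists_palindrome (Nat.zero_le k) (by omega : k ≤ s) (by omega : s ≤ k * (r + 1))).1
      exact ⟨l, hl, hf, by omega, hk⟩
end
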